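/- Suppose κ = κ^{<κ} > ℵ₀. Then κ is weakly compact if and only if the product of any two (<κ)-compact GO-spaces of weight ≤ κ is (<κ)-compact. -/

import Mathlib

universe u v

open Cardinal TopologicalSpace

/-- A topological space is `(<κ)`-compact if every open cover has a subcover of
cardinality strictly less than `κ`. -/
def KappaCompactSpace (κ : Cardinal.{u}) (X : Type u) [TopologicalSpace X] : Prop :=
  ∀ 𝒰 : Set (Set X), (∀ U ∈ 𝒰, IsOpen U) → ⋃₀ 𝒰 = Set.univ →
    ∃ 𝒱 ⊆ 𝒰, #𝒱 < κ ∧ ⋃₀ 𝒱 = Set.univ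

/-- `w(X) ≤ λ` : the space `X` has a base for its topology of cardinality at most `λ`. -/
def WeightLE (X : Type u) [TopologicalSpace X] (lam : Cardinal.{u}) : Prop :=
  ∃ B : Set (Set X), IsTopologicalBasis B ∧ #B ≤ lam

/-- The level of a node of a tree: the order type of its set of predecessors. -/
noncomputable def treeLevel {T : Type u} [PartialOrder T]
    (h : ∀ t : T, IsWellOrder {s : T // s < t} (fun a b => (a : T) < (b : T)))
    (t : T) : Ordinal.{u} :=
  @Ordinal.type {s : T // s < t} (fun a b => (a : T) < (b : T)) (h t)

/-- `κ` has the tree property: every tree of height `κ` all of whose levels have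
cardinality `< κ` has a branch (chain) of cardinality `κ`. -/
def TreeProperty (κ : Cardinal.{u}) : Prop :=
  ∀ (T : Type u) [PartialOrder T]
    (h : ∀ t : T, IsWellOrder {s : T // s < t} (fun a b => (a : T) < (b : T))),
    (∀ t : T, treeLevel h t < κ.ord) →
    (∀ β : Ordinal.{u}, β < κ.ord → ∃ t : T, treeLevel h t = β) →
    (∀ β : Ordinal.{u}, #{t : T | treeLevel h t = β} < κ) →
    ∃ B : Set T, IsChain (· ≤ ·) B ∧ #B = κ

/-- `κ` is weakly compact: strongly inaccessible with the tree property. -/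
def WeaklyCompactCard (κ : Cardinal.{u}) : Prop :=
  κ.IsInaccessible ∧ TreeProperty κ

/-- A GO-space: a Hausdorff space with a linear order having a base of
order-convex sets. -/
def IsGOSpace (X : Type u) [TopologicalSpace X] [LinearOrder X] : Prop :=
  T2Space X ∧ ∃ B : Set (Set X), IsTopologicalBasis B ∧ ∀ S ∈ B, S.OrdConnected

/-- In a linear order, every set has a cofinal subset of cardinality less than `κ`. -/
def SmallCofinal (κ : Cardinal.{u}) (L : Type u) [LE L] : Prop :=
  ∀ S : Set L, ∃ C ⊆ S, #C < κ ∧ ∀ s ∈ S, ∃ c ∈ C, s ≤ c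

theorem isRegular_of_powerlt_eq {κ : Cardinal.{u}} (hκ : ℵ₀ < κ) (hcard : κ ^< κ = κ) :
    κ.IsRegular := by
  refine ⟨hκ.le, ?_⟩
  by_contra! h
  have h1 := le_powerlt κ h
  rw [hcard] at h1
  exact (lt_power_cof_ord hκ.le).not_ge h1

theorem mk_Iio_ord_toType_lt {κ : Cardinal.{u}} (i : κ.ord.ToType) : #(Set.Iio i) < κ := by
  simpa using mk_Iio_lt i

theorem exists_forall_lt_of_mk_lt {κ : Cardinal.{u}} (hr : κ.IsRegular) {S : Set κ.ord.ToType}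
    (hS : #S < κ) : ∃ a, ∀ s ∈ S, s < a := by
  by_contra! h
  have : IsCofinal S := fun a => by
    obtain ⟨s, hs, h⟩ := h a
    exact ⟨s, hs, h⟩
  have h1 := Order.cof_le this
  rw [Ordinal.cof_toType, hr.cof_ord] at h1
  exact hS.not_ge h1

theorem exists_forall_lt_apply {κ : Cardinal.{u}} (hr : κ.IsRegular) {ι : Type u} (hι : #ι < κ)
    (f : ι → κ.ord.ToType) : ∃ a, ∀ i, f i < a := by
  obtain ⟨a, ha⟩ := exists_forall_lt_of_mk_lt hr (S := Set.range f) (mk_range_le.trans_lt hι)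
  exact ⟨a, fun i => ha _ ⟨i, rfl⟩⟩

theorem mk_iUnion_lt_of_isRegular {κ : Cardinal.{u}} (hr : κ.IsRegular) {ι α : Type u}
    (hι : #ι < κ) (f : ι → Set α) (hf : ∀ i, #(f i) < κ) : #(⋃ i, f i) < κ :=
  mk_iUnion_le_sum_mk.trans_lt (sum_lt_of_isRegular hr hι hf)

theorem mk_insert_lt_of_aleph0_le {κ : Cardinal.{u}} (hκ : ℵ₀ ≤ κ) {α : Type u} {S : Set α} {a : α}
    (hS : #S < κ) : #(insert a S : Set α) < κ :=
  mk_insert_le.trans_lt (add_lt_of_lt hκ hS (one_lt_aleph0.trans_le hκ))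

/-- A `κ`-sequence that is monotone past `a₀` and takes fewer than `κ` values is eventually
constant. -/
theorem eventually_const_of_monotone {κ : Cardinal.{u}} (hr : κ.IsRegular) {β : Type u}
    [PartialOrder β] (g : κ.ord.ToType → β) (hg : #(Set.range g) < κ) (a₀ : κ.ord.ToType)
    (hmono : ∀ a b, a₀ ≤ a → a ≤ b → g a ≤ g b) : ∃ a v, ∀ b, a ≤ b → g b = v := by
  by_cases h : ∃ v, ∀ a, ∃ b, a ≤ b ∧ g b = v
  · obtain ⟨v, hv⟩ := h
    obtain ⟨a, ha, hav⟩ := hv a₀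
    refine ⟨a, v, fun b hb => ?_⟩
    obtain ⟨c, hc, hcv⟩ := hv b
    exact le_antisymm (hcv ▸ hmono b c (ha.trans hb) hc) (hav ▸ hmono a b ha hb)
  · push Not at h
    choose f hf using h
    obtain ⟨a, ha⟩ := exists_forall_lt_apply hr hg (fun v => f v)
    exact absurd rfl (hf (g a) a (ha ⟨g a, a, rfl⟩).le)

/-- Coordinatewise stabilisation of lexicographically monotone `κ`-sequences. -/
theorem eventually_const_of_lex {κ : Cardinal.{u}} (hr : κ.IsRegular) {ι β : Type u}
    [LinearOrder ι] [WellFoundedLT ι] [PartialOrder β] (hι : ∀ i : ι, #(Set.Iio i) < κ)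
    (x : κ.ord.ToType → ι → β) (hx : ∀ i, #(Set.range fun a => x a i) < κ)
    (hmono : ∀ a b, a ≤ b → ∀ i, (∀ j < i, x a j = x b j) → x a i ≤ x b i) :
    ∀ i, ∃ a v, ∀ b, a ≤ b → x b i = v := by
  intro i
  induction i using WellFoundedLT.induction with
  | ind i ih =>
    choose A V hA using ih
    obtain ⟨a₀, ha₀⟩ := exists_forall_lt_apply hr (hι i) (fun j => A j j.2)
    refine eventually_const_of_monotone hr (fun a => x a i) (hx i) a₀ fun a b ha hab => ?_
    refine hmono a b hab i fun j hj => ?_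
    have := (ha₀ ⟨j, hj⟩).le
    rw [hA j hj a (this.trans ha), hA j hj b (this.trans (ha.trans hab))]

/-- A linear order violating `SmallCofinal κ` contains a strictly increasing `κ`-sequence. -/
theorem exists_strictMono_of_not_smallCofinal {κ : Cardinal.{u}} (hr : κ.IsRegular) {L : Type u}
    [LinearOrder L] (h : ¬ SmallCofinal κ L) : ∃ x : κ.ord.ToType → L, StrictMono x := by
  unfold SmallCofinal at h
  push Not at h
  obtain ⟨S, hS⟩ := h
  obtain ⟨s₀, hs₀, -⟩ := hS ∅ (Set.empty_subset _) (by simpa using hr.pos)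
  have : ∀ C : Set L, ∃ s ∈ S, C ⊆ S → #C < κ → ∀ c ∈ C, c < s := by
    intro C
    by_cases hC : C ⊆ S ∧ #C < κ
    · obtain ⟨s, hs⟩ := hS C hC.1 hC.2
      exact ⟨s, hs.1, fun _ _ => hs.2⟩
    · exact ⟨s₀, hs₀, fun h1 h2 => absurd ⟨h1, h2⟩ hC⟩
  choose g hgS hg using this
  let x : κ.ord.ToType → L := WellFoundedLT.fix fun a ih =>
    g (Set.range fun b : Set.Iio a => ih b b.2)
  have hx : ∀ a, x a = g (Set.range fun b : Set.Iio a => x b) := fun a =>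
    WellFoundedLT.fix_eq _ a
  refine ⟨x, fun a b hab => ?_⟩
  rw [hx b]
  refine hg _ ?_ (mk_range_le.trans_lt (mk_Iio_ord_toType_lt b)) _ ⟨⟨a, hab⟩, rfl⟩
  rintro _ ⟨c, rfl⟩
  change x c ∈ S
  rw [hx c]
  exact hgS _

/-- The topology on a linear order generated by the half-open intervals `[x, y)` and `[x, →)`. -/
abbrev sorgenfreyTopology (M : Type u) [LinearOrder M] : TopologicalSpace M where
  IsOpen U := ∀ x ∈ U, ∃ b : WithTop M, x < b ∧ ∀ z, x ≤ z → (z : WithTop M) < b → z ∈ U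
  isOpen_univ _ _ := ⟨⊤, WithTop.coe_lt_top _, fun _ _ _ => trivial⟩
  isOpen_inter U V hU hV x hx := by
    obtain ⟨b, hb, hbU⟩ := hU x hx.1
    obtain ⟨c, hc, hcV⟩ := hV x hx.2
    refine ⟨min b c, lt_min hb hc, fun z hz hzb => ?_⟩
    exact ⟨hbU z hz (hzb.trans_le (min_le_left _ _)), hcV z hz (hzb.trans_le (min_le_right _ _))⟩
  isOpen_sUnion 𝒰 h x := by
    rintro ⟨U, hU, hx⟩
    obtain ⟨b, hb, hbU⟩ := h U hU x hx
    exact ⟨b, hb, fun z hz hzb => ⟨U, hU, hbU z hz hzb⟩⟩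

theorem isOpen_sorgenfrey_iff {M : Type u} [LinearOrder M] {U : Set M} :
    @IsOpen M (sorgenfreyTopology M) U ↔
      ∀ x ∈ U, ∃ b : WithTop M, x < b ∧ ∀ z, x ≤ z → (z : WithTop M) < b → z ∈ U :=
  Iff.rfl

theorem isOpen_sorgenfrey_halfOpen {M : Type u} [LinearOrder M] (a : M) (b : WithTop M) :
    @IsOpen M (sorgenfreyTopology M) {z | a ≤ z ∧ (z : WithTop M) < b} :=
  isOpen_sorgenfrey_iff.2 fun _ hx => ⟨b, hx.2, fun _ hz hzb => ⟨hx.1.trans hz, hzb⟩⟩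

theorem isOpen_sorgenfrey_Ici {M : Type u} [LinearOrder M] (a : M) :
    @IsOpen M (sorgenfreyTopology M) (Set.Ici a) :=
  isOpen_sorgenfrey_iff.2 fun x hx =>
    ⟨⊤, WithTop.coe_lt_top x, fun _ hz _ => le_trans (Set.mem_Ici.1 hx) hz⟩

theorem isOpen_sorgenfrey_Iio {M : Type u} [LinearOrder M] (a : M) :
    @IsOpen M (sorgenfreyTopology M) (Set.Iio a) :=
  isOpen_sorgenfrey_iff.2 fun _ hx =>
    ⟨a, WithTop.coe_lt_coe.2 hx, fun _ _ hz => WithTop.coe_lt_coe.1 hz⟩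

theorem isTopologicalBasis_sorgenfrey (M : Type u) [LinearOrder M] :
    @IsTopologicalBasis M (sorgenfreyTopology M)
      (Set.range fun p : M × WithTop M => {z | p.1 ≤ z ∧ (z : WithTop M) < p.2}) := by
  let _ := sorgenfreyTopology M
  refine isTopologicalBasis_of_isOpen_of_nhds ?_ ?_
  · rintro _ ⟨p, rfl⟩
    exact isOpen_sorgenfrey_halfOpen _ _
  · intro x U hx hU
    obtain ⟨b, hb, hbU⟩ := isOpen_sorgenfrey_iff.1 hU x hx
    exact ⟨_, ⟨(x, b), rfl⟩, ⟨le_rfl, hb⟩, fun z hz => hbU z hz.1 hz.2⟩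

theorem isGOSpace_sorgenfrey (M : Type u) [LinearOrder M] :
    @IsGOSpace M (sorgenfreyTopology M) _ := by
  let _ := sorgenfreyTopology M
  refine ⟨⟨fun x y hxy => ?_⟩, _, isTopologicalBasis_sorgenfrey M, ?_⟩
  · rcases hxy.lt_or_gt with h | h
    · exact ⟨_, _, isOpen_sorgenfrey_Iio y, isOpen_sorgenfrey_Ici y, h, le_rfl,
        (Set.Iio_disjoint_Ici le_rfl)⟩
    · exact ⟨_, _, isOpen_sorgenfrey_Ici x, isOpen_sorgenfrey_Iio x, le_rfl, h,
        (Set.Iio_disjoint_Ici le_rfl).symm⟩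
  · rintro _ ⟨p, rfl⟩
    exact ⟨fun a ha b hb c hc =>
      ⟨ha.1.trans hc.1, (WithTop.coe_le_coe.2 hc.2).trans_lt hb.2⟩⟩

theorem weightLE_sorgenfrey {κ : Cardinal.{u}} (hκ : ℵ₀ ≤ κ) (M : Type u) [LinearOrder M]
    (hM : #M ≤ κ) : @WeightLE M (sorgenfreyTopology M) κ := by
  refine ⟨_, isTopologicalBasis_sorgenfrey M, mk_range_le.trans ?_⟩
  have h : #(WithTop M) ≤ κ := by
    change #(Option M) ≤ κ
    rw [mk_option]
    exact add_le_of_le hκ hM (one_le_aleph0.trans hκ)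
  rw [mk_prod, lift_id, lift_id]
  exact (mul_le_mul' hM h).trans (mul_eq_self hκ).le

theorem kappaCompactSpace_sorgenfrey {κ : Cardinal.{u}} (hr : κ.IsRegular) (M : Type u)
    [CompleteLinearOrder M] (hM : SmallCofinal κ M) :
    @KappaCompactSpace κ M (sorgenfreyTopology M) := by
  intro 𝒰 hopen hcov
  let S : Set M := {x | ∃ 𝒱 ⊆ 𝒰, #𝒱 < κ ∧ Set.Iic x ⊆ ⋃₀ 𝒱}
  obtain ⟨C, hCS, hC, hcof⟩ := hM S
  choose! 𝒱 h𝒱 h𝒱κ h𝒱c using fun x (hx : x ∈ S) => hx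
  obtain ⟨U, hU, hsU⟩ : sSup S ∈ ⋃₀ 𝒰 := hcov ▸ Set.mem_univ _
  obtain ⟨b, hb, hbU⟩ := isOpen_sorgenfrey_iff.1 (hopen U hU) _ hsU
  let 𝒲 : Set (Set M) := insert U (⋃ c : C, 𝒱 c)
  have h𝒲 : 𝒲 ⊆ 𝒰 := Set.insert_subset hU (Set.iUnion_subset fun c => h𝒱 c (hCS c.2))
  have h𝒲κ : #𝒲 < κ := mk_insert_lt_of_aleph0_le hr.aleph0_le
    (mk_iUnion_lt_of_isRegular hr hC _ fun c => h𝒱κ c (hCS c.2))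
  have h𝒲c : ∀ z : M, (z : WithTop M) < b → z ∈ ⋃₀ 𝒲 := by
    intro z hz
    rcases le_or_gt (sSup S) z with h | h
    · exact ⟨U, Set.mem_insert _ _, hbU z h hz⟩
    · obtain ⟨x, hx, hzx⟩ := lt_sSup_iff.1 h
      obtain ⟨c, hc, hxc⟩ := hcof x hx
      obtain ⟨V, hV, hzV⟩ := h𝒱c c (hCS hc) (hzx.le.trans hxc)
      exact ⟨V, Set.mem_insert_of_mem _ (Set.mem_iUnion.2 ⟨⟨c, hc⟩, hV⟩), hzV⟩
  induction b with
  | top => exact ⟨𝒲, h𝒲, h𝒲κ, Set.eq_univ_of_forall fun z => h𝒲c z (WithTop.coe_lt_top z)⟩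
  | coe c =>
    obtain ⟨V, hV, hcV⟩ : c ∈ ⋃₀ 𝒰 := hcov ▸ Set.mem_univ _
    have hcS : c ∈ S := by
      refine ⟨insert V 𝒲, Set.insert_subset hV h𝒲,
        mk_insert_lt_of_aleph0_le hr.aleph0_le h𝒲κ, fun z hz => ?_⟩
      rcases (Set.mem_Iic.1 hz).eq_or_lt with rfl | h
      · exact ⟨V, Set.mem_insert _ _, hcV⟩
      · obtain ⟨W, hW, hzW⟩ := h𝒲c z (WithTop.coe_lt_coe.2 h)
        exact ⟨W, Set.mem_insert_of_mem _ hW, hzW⟩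
    exact absurd (le_sSup hcS) (not_le.2 (WithTop.coe_lt_coe.1 hb))

theorem not_kappaCompactSpace_sorgenfrey_prod {κ : Cardinal.{u}} (M : Type u) [LinearOrder M]
    (hM : κ ≤ #M) :
    ¬ @KappaCompactSpace κ (M × Mᵒᵈ)
      (@instTopologicalSpaceProd _ _ (sorgenfreyTopology M) (sorgenfreyTopology Mᵒᵈ)) := by
  let _ := sorgenfreyTopology M
  let _ := sorgenfreyTopology Mᵒᵈ
  intro h
  let A : M → Set (M × Mᵒᵈ) := fun x => Set.Ici x ×ˢ Set.Ici (OrderDual.toDual x)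
  let W : Set (M × Mᵒᵈ) := {p | p.1 < OrderDual.ofDual p.2}
  have hW : IsOpen W := by
    refine isOpen_prod_iff.2 fun u v (huv : u < OrderDual.ofDual v) => ?_
    by_cases hz : ∃ z, u < z ∧ z < OrderDual.ofDual v
    · obtain ⟨z, hz1, hz2⟩ := hz
      exact ⟨Set.Iio z, Set.Iio (OrderDual.toDual z), isOpen_sorgenfrey_Iio _,
        isOpen_sorgenfrey_Iio _, hz1, hz2, fun p hp => lt_trans (b := z) hp.1 hp.2⟩
    · push Not at hz
      refine ⟨Set.Iio (OrderDual.ofDual v), Set.Iio (OrderDual.toDual u), isOpen_sorgenfrey_Iio _,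
        isOpen_sorgenfrey_Iio _, huv, huv, fun p hp => ?_⟩
      have h2 : u < OrderDual.ofDual p.2 := hp.2
      exact lt_of_lt_of_le hp.1 (hz _ h2)
  have hcov : ⋃₀ (insert W (Set.range A)) = Set.univ := by
    refine Set.eq_univ_of_forall fun p => ?_
    rcases lt_or_ge p.1 (OrderDual.ofDual p.2) with hp | hp
    · exact ⟨W, Set.mem_insert _ _, hp⟩
    · exact ⟨A p.1, Set.mem_insert_of_mem _ ⟨_, rfl⟩, le_rfl, hp⟩
  obtain ⟨𝒱, h𝒱, h𝒱κ, h𝒱c⟩ := h _ (by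
    rintro U (rfl | ⟨x, rfl⟩)
    · exact hW
    · exact (isOpen_sorgenfrey_Ici x).prod (isOpen_sorgenfrey_Ici _)) hcov
  have hA : ∀ z x, (z, OrderDual.toDual z) ∈ A x → z = x := fun z x hz =>
    le_antisymm hz.2 hz.1
  have hmem : ∀ z, A z ∈ 𝒱 := by
    intro z
    obtain ⟨V, hV, hzV⟩ : (z, OrderDual.toDual z) ∈ ⋃₀ 𝒱 := h𝒱c ▸ Set.mem_univ _
    rcases h𝒱 hV with rfl | ⟨x, rfl⟩
    · exact absurd hzV (lt_irrefl z)
    · rwa [hA z x hzV]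
  have hinj : Function.Injective fun z => (⟨A z, hmem z⟩ : 𝒱) := fun z z' hzz => by
    have h1 : A z = A z' := congrArg Subtype.val hzz
    exact hA z z' (h1 ▸ ⟨le_rfl, le_rfl⟩)
  exact h𝒱κ.not_ge (hM.trans (mk_le_of_injective hinj))

theorem smallCofinal_lowerSet {κ : Cardinal.{u}} (hr : κ.IsRegular) {L : Type u} [LinearOrder L]
    (h : SmallCofinal κ L) : SmallCofinal κ (LowerSet L) := by
  intro 𝒮
  by_cases hmax : ∃ m ∈ 𝒮, ∀ s ∈ 𝒮, s ≤ m
  · obtain ⟨m, hm, hms⟩ := hmax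
    exact ⟨{m}, by simpa using hm, by simpa using hr.nat_lt 1, fun s hs => ⟨m, rfl, hms s hs⟩⟩
  · push Not at hmax
    obtain ⟨C, hCS, hC, hcof⟩ := h {l | ∃ A ∈ 𝒮, l ∈ A}
    choose A hA hcA using fun c : C => hCS c.2
    refine ⟨Set.range A, Set.range_subset_iff.2 hA, mk_range_le.trans_lt hC, fun s hs => ?_⟩
    obtain ⟨B, hB, hBs⟩ := hmax s hs
    obtain ⟨l, hlB, hls⟩ := Set.not_subset.1 hBs.not_ge
    obtain ⟨c, hc, hlc⟩ := hcof l ⟨B, hB, hlB⟩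
    refine ⟨_, ⟨⟨c, hc⟩, rfl⟩, (le_total _ _).resolve_right fun hle => ?_⟩
    exact hls (s.lower hlc (hle (hcA ⟨c, hc⟩)))

theorem smallCofinal_dual_lowerSet {κ : Cardinal.{u}} (hr : κ.IsRegular) {L : Type u}
    [LinearOrder L] (h : SmallCofinal κ Lᵒᵈ) : SmallCofinal κ (LowerSet L)ᵒᵈ := by
  suffices H : ∀ 𝒮 : Set (LowerSet L), ∃ C ⊆ 𝒮, #C < κ ∧ ∀ s ∈ 𝒮, ∃ c ∈ C, c ≤ s from H
  replace h : ∀ S : Set L, ∃ C ⊆ S, #C < κ ∧ ∀ s ∈ S, ∃ c ∈ C, c ≤ s := h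
  intro 𝒮
  by_cases hmin : ∃ m ∈ 𝒮, ∀ s ∈ 𝒮, m ≤ s
  · obtain ⟨m, hm, hms⟩ := hmin
    exact ⟨{m}, by simpa using hm, by simpa using hr.nat_lt 1, fun s hs => ⟨m, rfl, hms s hs⟩⟩
  · push Not at hmin
    obtain ⟨C, hCS, hC, hcof⟩ := h {l | ∃ A ∈ 𝒮, l ∉ A}
    choose A hA hcA using fun c : C => hCS c.2
    refine ⟨Set.range A, Set.range_subset_iff.2 hA, mk_range_le.trans_lt hC, fun s hs => ?_⟩
    obtain ⟨B, hB, hBs⟩ := hmin s hs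
    obtain ⟨l, hls, hlB⟩ := Set.not_subset.1 hBs.not_ge
    obtain ⟨c, hc, hcl⟩ := hcof l ⟨B, hB, hlB⟩
    refine ⟨_, ⟨⟨c, hc⟩, rfl⟩, (le_total _ _).resolve_right fun hle => ?_⟩
    exact hcA ⟨c, hc⟩ (hle (s.lower hcl hls))

theorem mk_lowerSet_le {κ : Cardinal.{u}} (hκ : ℵ₀ ≤ κ) (hcard : κ ^< κ = κ) {L : Type u}
    [LinearOrder L] (hL : #L ≤ κ) (h : SmallCofinal κ L) : #(LowerSet L) ≤ κ := by
  let F : (Σ a : κ.ord.ToType, Set.Iio a → L) → LowerSet L := fun p => lowerClosure (Set.range p.2)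
  have hF : Function.Surjective F := by
    intro A
    obtain ⟨C, hCA, hC, hcof⟩ := h A
    have ho : (#C).ord < κ.ord := ord_lt_ord.2 hC
    let a : κ.ord.ToType := Ordinal.ToType.mk ⟨_, ho⟩
    have ha : #(Set.Iio a) = #C := by
      change #{y // y < a} = #C
      rw [← Ordinal.card_typein (α := κ.ord.ToType) (r := (· < ·)) a]
      change (Ordinal.ToType.mk.symm a : Ordinal).card = _
      simp [a]
    obtain ⟨e⟩ := Cardinal.eq.1 ha
    refine ⟨⟨a, fun i => e i⟩, ?_⟩
    ext l
    constructor
    · rintro ⟨_, ⟨i, rfl⟩, hl⟩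
      exact A.lower hl (hCA (e i).2)
    · intro hl
      obtain ⟨c, hc, hlc⟩ := hcof l hl
      exact ⟨c, ⟨e.symm ⟨c, hc⟩, by simp⟩, hlc⟩
  refine (mk_le_of_surjective hF).trans ?_
  rw [mk_sigma]
  refine (sum_le_sum _ (fun _ => κ) fun a => ?_).trans ?_
  · rw [mk_arrow, lift_id, lift_id]
    refine (power_le_power_right hL).trans ?_
    conv_rhs => rw [← hcard]
    exact le_powerlt κ (mk_Iio_ord_toType_lt a)
  · simp [mul_eq_self hκ]

/-- If products of `(<κ)`-compact GO-spaces are `(<κ)`-compact, then every linear order of size `κ`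
contains a strictly monotone `κ`-sequence. -/
theorem exists_monotone_sequence_of_products {κ : Cardinal.{u}} (hκ : ℵ₀ < κ)
    (hcard : κ ^< κ = κ)
    (H : ∀ (X Y : Type u) [TopologicalSpace X] [TopologicalSpace Y]
        [LinearOrder X] [LinearOrder Y], IsGOSpace X → IsGOSpace Y →
        KappaCompactSpace κ X → KappaCompactSpace κ Y →
        WeightLE X κ → WeightLE Y κ →
        KappaCompactSpace κ (X × Y))
    (L : Type u) [LinearOrder L] (hL : #L = κ) :
    ∃ x : κ.ord.ToType → L, StrictMono x ∨ StrictAnti x := by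
  have hr := isRegular_of_powerlt_eq hκ hcard
  by_contra! hno
  have h1 : SmallCofinal κ L := by
    by_contra h
    obtain ⟨x, hx⟩ := exists_strictMono_of_not_smallCofinal hr h
    exact (hno x).1 hx
  have h2 : SmallCofinal κ Lᵒᵈ := by
    by_contra h
    obtain ⟨x, hx⟩ := exists_strictMono_of_not_smallCofinal hr h
    exact (hno fun a => OrderDual.ofDual (x a)).2 fun a b hab => hx hab
  have hle : #(LowerSet L) ≤ κ := mk_lowerSet_le hκ.le hcard hL.le h1
  have hge : κ ≤ #(LowerSet L) :=
    hL ▸ mk_le_of_injective (f := LowerSet.Iic) LowerSet.Iic_injective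
  refine not_kappaCompactSpace_sorgenfrey_prod (LowerSet L) hge ?_
  let _ := sorgenfreyTopology (LowerSet L)
  let _ := sorgenfreyTopology (LowerSet L)ᵒᵈ
  exact H _ _ (isGOSpace_sorgenfrey _) (isGOSpace_sorgenfrey _)
    (kappaCompactSpace_sorgenfrey hr _ (smallCofinal_lowerSet hr h1))
    (kappaCompactSpace_sorgenfrey hr _ (smallCofinal_dual_lowerSet hr h2))
    (weightLE_sorgenfrey hκ.le _ hle) (weightLE_sorgenfrey hκ.le _ hle)

/-- If every linear order of size `κ` contains a strictly monotone `κ`-sequence, then any `κ`-sized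
family of functions with few values in each coordinate contains a pointwise eventually constant
injective `κ`-sequence. -/
theorem exists_eventually_const_of_monotone_sequences {κ : Cardinal.{u}} (hr : κ.IsRegular)
    (hmono : ∀ (L : Type u) [LinearOrder L], #L = κ →
      ∃ x : κ.ord.ToType → L, StrictMono x ∨ StrictAnti x)
    {S ι β : Type u} [LinearOrder ι] [WellFoundedLT ι] [LinearOrder β]
    (hι : ∀ i : ι, #(Set.Iio i) < κ) (hS : #S = κ) (F : S → ι → β) (hF : Function.Injective F)
    (hval : ∀ i, #(Set.range fun s => F s i) < κ) :
    ∃ x : κ.ord.ToType → S, Function.Injective x ∧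
      ∀ i, ∃ a v, ∀ b, a ≤ b → F (x b) i = v := by
  let _ : LinearOrder S := LinearOrder.lift' (fun s => toLex (F s)) (toLex.injective.comp hF)
  have hx (x : κ.ord.ToType → S) (i : ι) : #(Set.range fun a => F (x a) i) < κ :=
    (mk_le_mk_of_subset (Set.range_comp_subset_range x fun s => F s i)).trans_lt (hval i)
  obtain ⟨x, h | h⟩ := hmono S hS
  · exact ⟨x, h.injective, eventually_const_of_lex hr hι (fun a => F (x a)) (hx x)
      fun a b hab i hi => Pi.apply_le_of_toLex (h.monotone hab) hi⟩
  · exact ⟨x, h.injective, eventually_const_of_lex (β := βᵒᵈ) hr hι (fun a => F (x a)) (hx x)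
      fun a b hab i hi => Pi.apply_le_of_toLex (β := fun _ => β) (h.antitone hab)
        fun j hj => (hi j hj).symm⟩

theorem isStrongPrelimit_of_monotone_sequences {κ : Cardinal.{u}} (hr : κ.IsRegular)
    (hcard : κ ^< κ = κ)
    (hmono : ∀ (L : Type u) [LinearOrder L], #L = κ →
      ∃ x : κ.ord.ToType → L, StrictMono x ∨ StrictAnti x) : IsStrongPrelimit κ := by
  intro c hc
  by_contra! h
  have h2 : (2 : Cardinal) < κ := hr.nat_lt 2
  have hS : #(c.ord.ToType → ULift.{u} Bool) = κ := by
    rw [mk_arrow]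
    simp only [mk_ord_toType, lift_id, mk_uLift, mk_bool, lift_ofNat]
    refine le_antisymm ?_ h
    refine (power_le_power_right h2.le).trans ?_
    conv_rhs => rw [← hcard]
    exact le_powerlt κ hc
  obtain ⟨x, hx, hconst⟩ := exists_eventually_const_of_monotone_sequences hr hmono
    (fun i : c.ord.ToType => (mk_Iio_ord_toType_lt i).trans hc) hS id Function.injective_id
    (fun i => (mk_le_of_injective Subtype.val_injective).trans_lt (by simpa using h2))
  choose A V hA using hconst
  obtain ⟨a, ha⟩ := exists_forall_lt_apply hr (by simpa using hc) A
  obtain ⟨b, hb⟩ := exists_forall_lt_of_mk_lt hr (S := {a}) (by simpa using hr.nat_lt 1)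
  have hab := hb a rfl
  refine hab.ne (hx (funext fun i => ?_))
  exact (hA i a (ha i).le).trans (hA i b ((ha i).le.trans hab.le)).symm

section Tree

variable {T : Type u} [PartialOrder T]
  (h : ∀ t : T, IsWellOrder {s : T // s < t} (fun a b => (a : T) < (b : T)))

theorem treeLevel_eq_typein {s t : T} (hst : s < t) :
    treeLevel h s =
      @Ordinal.typein {s : T // s < t} (fun a b => (a : T) < (b : T)) (h t) ⟨s, hst⟩ := by
  have := h t
  have := h s
  rw [← Ordinal.type_subrel]
  refine RelIso.ordinalType_congr ⟨⟨fun x => ⟨⟨x.1, x.2.trans hst⟩, x.2⟩, fun x => ⟨x.1.1, x.2⟩,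
    fun _ => rfl, fun _ => rfl⟩, Iff.rfl⟩

theorem treeLevel_lt_treeLevel {s t : T} (hst : s < t) : treeLevel h s < treeLevel h t := by
  have := h t
  rw [treeLevel_eq_typein h hst]
  exact Ordinal.typein_lt_type _ _

theorem exists_lt_treeLevel_eq {t : T} {β : Ordinal.{u}} (hβ : β < treeLevel h t) :
    ∃ s < t, treeLevel h s = β := by
  have := h t
  obtain ⟨⟨s, hs⟩, hsβ⟩ := Ordinal.typein_surj _ hβ
  exact ⟨s, hs, (treeLevel_eq_typein h hs).trans hsβ⟩

include h in
theorem le_or_le_of_common_upper {s s' t : T} (hs : s ≤ t) (hs' : s' ≤ t) : s ≤ s' ∨ s' ≤ s := by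
  rcases hs.eq_or_lt with rfl | hs
  · exact Or.inr hs'
  rcases hs'.eq_or_lt with rfl | hs'
  · exact Or.inl hs.le
  have := h t
  rcases trichotomous_of (fun a b : {s : T // s < t} => (a : T) < (b : T)) ⟨s, hs⟩ ⟨s', hs'⟩ with
    h | h | h
  · exact Or.inl h.le
  · exact Or.inl (congrArg Subtype.val h).le
  · exact Or.inr h.le

theorem eq_of_treeLevel_eq {s s' t : T} (hs : s ≤ t) (hs' : s' ≤ t)
    (heq : treeLevel h s = treeLevel h s') : s = s' := by
  rcases le_or_le_of_common_upper h hs hs' with hle | hle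
  · exact hle.eq_of_not_lt fun hlt => (treeLevel_lt_treeLevel h hlt).ne heq
  · exact (hle.eq_of_not_lt fun hlt => (treeLevel_lt_treeLevel h hlt).ne heq.symm).symm

end Tree

theorem treeProperty_of_monotone_sequences {κ : Cardinal.{u}} (hr : κ.IsRegular)
    (hmono : ∀ (L : Type u) [LinearOrder L], #L = κ →
      ∃ x : κ.ord.ToType → L, StrictMono x ∨ StrictAnti x) : TreeProperty κ := by
  intro T _ h hheight hne hsmall
  let lev : κ.ord.ToType → Ordinal.{u} := fun i => (Ordinal.ToType.mk.symm i).1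
  have hlev : ∀ i, lev i < κ.ord := fun i => (Ordinal.ToType.mk.symm i).2
  have hlev_lt : ∀ i j, lev i < lev j ↔ i < j := fun i j =>
    Ordinal.ToType.mk.symm.lt_iff_lt (x := i) (y := j)
  have hlev_inj : Function.Injective lev := fun i j hij =>
    Ordinal.ToType.mk.symm.injective (Subtype.ext hij)
  have hlev_surj : ∀ o < κ.ord, ∃ i, lev i = o := fun o ho =>
    ⟨Ordinal.ToType.mk ⟨o, ho⟩, by simp [lev]⟩
  have hT : #T = κ := by
    refine le_antisymm ?_ ?_
    · have huniv : (Set.univ : Set T) = ⋃ i, {t : T | treeLevel h t = lev i} := by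
        refine (Set.eq_univ_of_forall fun t => ?_).symm
        obtain ⟨i, hi⟩ := hlev_surj _ (hheight t)
        exact Set.mem_iUnion.2 ⟨i, hi.symm⟩
      rw [← mk_univ, huniv]
      refine mk_iUnion_le_sum_mk.trans ((sum_le_sum _ _ fun i => (hsmall (lev i)).le).trans ?_)
      simp [mul_eq_self hr.aleph0_le]
    · choose t ht using fun i => hne (lev i) (hlev i)
      have : Function.Injective t := fun i j hij => hlev_inj (by rw [← ht i, hij, ht j])
      simpa using mk_le_of_injective this
  obtain ⟨e⟩ : Nonempty (T ≃ κ.ord.ToType) := Cardinal.eq.1 (by simpa using hT)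
  classical
  let F : T → κ.ord.ToType → WithBot κ.ord.ToType := fun t i =>
    if hs : ∃ s ≤ t, treeLevel h s = lev i then (e hs.choose : WithBot κ.ord.ToType) else ⊥
  have hF_of_le : ∀ {s t : T} {i : κ.ord.ToType}, s ≤ t → treeLevel h s = lev i → F t i = e s := by
    intro s t i hst hs
    have hex : ∃ s ≤ t, treeLevel h s = lev i := ⟨s, hst, hs⟩
    simp only [F, dif_pos hex]
    rw [eq_of_treeLevel_eq h hex.choose_spec.1 hst (hex.choose_spec.2.trans hs.symm)]
  have hF_coe : ∀ {t : T} {i k : κ.ord.ToType}, F t i = (k : WithBot κ.ord.ToType) →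
      ∃ s ≤ t, treeLevel h s = lev i ∧ e s = k := by
    intro t i k hk
    by_cases hex : ∃ s ≤ t, treeLevel h s = lev i
    · simp only [F, dif_pos hex] at hk
      exact ⟨_, hex.choose_spec.1, hex.choose_spec.2, WithBot.coe_injective hk⟩
    · simp only [F, dif_neg hex] at hk
      exact absurd hk.symm (WithBot.coe_ne_bot)
  have hF_bot : ∀ {t : T} {i : κ.ord.ToType}, F t i = ⊥ → treeLevel h t < lev i := by
    intro t i hti
    by_contra! hle
    obtain ⟨s, hst, hs⟩ : ∃ s ≤ t, treeLevel h s = lev i := by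
      rcases hle.eq_or_lt with heq | hlt
      · exact ⟨t, le_rfl, heq.symm⟩
      · obtain ⟨s, hs, hsi⟩ := exists_lt_treeLevel_eq h hlt
        exact ⟨s, hs.le, hsi⟩
    rw [hF_of_le hst hs] at hti
    exact WithBot.coe_ne_bot hti
  have hF_le : ∀ {t t' : T}, F t = F t' → t ≤ t' := by
    intro t t' htt
    obtain ⟨i, hi⟩ := hlev_surj _ (hheight t)
    have h1 := hF_of_le le_rfl hi.symm
    rw [htt] at h1
    obtain ⟨s, hs, -, hse⟩ := hF_coe h1
    rwa [← e.injective hse]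
  have hval : ∀ i, #(Set.range fun t => F t i) < κ := by
    intro i
    have hsub : (Set.range fun t => F t i) ⊆
        insert ⊥ ((fun s => (e s : WithBot κ.ord.ToType)) '' {t : T | treeLevel h t = lev i}) := by
      rintro _ ⟨t, rfl⟩
      change F t i ∈ _
      rcases hv : F t i with _ | k
      · exact Set.mem_insert _ _
      · obtain ⟨s, -, hs, hsk⟩ := hF_coe hv
        exact Set.mem_insert_of_mem _ ⟨s, hs, congrArg _ hsk⟩
    exact (mk_le_mk_of_subset hsub).trans_lt
      (mk_insert_lt_of_aleph0_le hr.aleph0_le (mk_image_le.trans_lt (hsmall _)))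
  obtain ⟨x, hx, hconst⟩ := exists_eventually_const_of_monotone_sequences hr hmono
    mk_Iio_ord_toType_lt hT F (fun t t' htt => le_antisymm (hF_le htt) (hF_le htt.symm)) hval
  have hbranch : ∀ i, ∃ a s, treeLevel h s = lev i ∧ ∀ b, a ≤ b → s ≤ x b := by
    intro i
    obtain ⟨a, v, hav⟩ := hconst i
    induction v with
    | bot =>
      exfalso
      have hsub : x '' Set.Ici a ⊆ ⋃ j : Set.Iio i, {t : T | treeLevel h t = lev j} := by
        rintro _ ⟨b, hb, rfl⟩
        obtain ⟨j, hj⟩ := hlev_surj _ (hheight (x b))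
        have hlt := hF_bot (hav b hb)
        rw [← hj, hlev_lt] at hlt
        exact Set.mem_iUnion.2 ⟨⟨j, hlt⟩, hj.symm⟩
      have hlt := (mk_le_mk_of_subset hsub).trans_lt
        (mk_iUnion_lt_of_isRegular hr (mk_Iio_ord_toType_lt i) _ fun j => hsmall _)
      rw [mk_image_eq hx] at hlt
      obtain ⟨c, hc⟩ := exists_forall_lt_of_mk_lt hr hlt
      exact lt_irrefl c (hc c (hc a (Set.mem_Ici.2 le_rfl)).le)
    | coe k =>
      obtain ⟨s, -, hs, hsk⟩ := hF_coe (hav a le_rfl)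
      refine ⟨a, s, hs, fun b hb => ?_⟩
      obtain ⟨s', hs', -, hsk'⟩ := hF_coe (hav b hb)
      rwa [e.injective (hsk.trans hsk'.symm)]
  choose A s hs hsx using hbranch
  have hs_inj : Function.Injective s := fun i j hij => hlev_inj (by rw [← hs i, hij, hs j])
  refine ⟨Set.range s, ?_, by simp [mk_range_eq s hs_inj]⟩
  rintro _ ⟨i, rfl⟩ _ ⟨j, rfl⟩ -
  exact le_or_le_of_common_upper h (hsx i (max (A i) (A j)) (le_max_left _ _))
    (hsx j _ (le_max_right _ _))

/-- The key combinatorial consequence of weak compactness: a `κ`-sequence of functions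
`κ → β`, with `β` small, has a function all of whose proper initial segments agree with arbitrarily
late members of the sequence. -/
theorem WeaklyCompactCard.exists_coherent {κ : Cardinal.{u}} (hκ : WeaklyCompactCard κ) {β : Type u}
    [Inhabited β] (hβ : #β < κ) (f : κ.ord.ToType → κ.ord.ToType → β) :
    ∃ g : κ.ord.ToType → β, ∀ i, ∃ a, i < a ∧ ∀ j < i, f a j = g j := by
  have hr := hκ.1.isRegular
  let K := κ.ord.ToType
  let cut : K → (K → β) → K → β := fun i g j => if j < i then g j else default
  have hcut : ∀ {i j : K} {g}, j < i → cut i g j = g j := fun hj => if_pos hj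
  let T : Type u := {p : K × (K → β) // ∃ a, p.1 ≤ a ∧ p.2 = cut p.1 (f a)}
  let _ : PartialOrder T :=
    { le := fun p q => p.1.1 ≤ q.1.1 ∧ ∀ i < p.1.1, p.1.2 i = q.1.2 i
      le_refl := fun p => ⟨le_rfl, fun _ _ => rfl⟩
      le_trans := fun p q r hpq hqr => ⟨hpq.1.trans hqr.1, fun i hi =>
        (hpq.2 i hi).trans (hqr.2 i (hi.trans_le hpq.1))⟩
      le_antisymm := by
        rintro ⟨⟨i, p⟩, a, ha, hp⟩ ⟨⟨j, q⟩, b, hb, hq⟩ ⟨hij, h1⟩ ⟨hji, h2⟩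
        obtain rfl : i = j := le_antisymm hij hji
        dsimp only at *
        have : p = q := by
          funext k
          by_cases hk : k < i
          · exact h1 k hk
          · have hp' : p = cut i (f a) := hp
            have hq' : q = cut i (f b) := hq
            rw [hp', hq']
            simp [cut, hk]
        subst this
        rfl }
  have hT_eq : ∀ {p q : T}, p ≤ q → p.1.1 = q.1.1 → p = q := fun {p q} hpq heq =>
    le_antisymm hpq ⟨heq.ge, fun i hi => (hpq.2 i (heq ▸ hi)).symm⟩
  have hT_lt : ∀ {p q : T}, p < q → p.1.1 < q.1.1 := fun {p q} hpq =>
    hpq.le.1.lt_of_ne fun heq => hpq.ne (hT_eq hpq.le heq)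
  have hrestrict : ∀ (p : T) (i : K), i < p.1.1 → ∃ q < p, q.1.1 = i := by
    rintro ⟨⟨k, p⟩, a, ha, hp⟩ i hi
    dsimp only at *
    refine ⟨⟨(i, cut i p), a, hi.le.trans ha, ?_⟩, ?_, rfl⟩
    · funext j
      by_cases hj : j < i
      · have hp' : p = cut k (f a) := hp
        change cut i p j = cut i (f a) j
        rw [hcut hj, hcut hj, hp', hcut (hj.trans hi)]
      · simp [cut, hj]
    · refine lt_of_le_of_ne ⟨hi.le, fun j hj => hcut hj⟩ fun heq => hi.ne ?_
      exact congrArg (fun t : T => t.1.1) heq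
  have hcomp : ∀ {p q r : T}, p ≤ r → q ≤ r → p.1.1 ≤ q.1.1 → p ≤ q := fun hpr hqr hpq =>
    ⟨hpq, fun i hi => (hpr.2 i hi).trans (hqr.2 i (hi.trans_le hpq)).symm⟩
  have hiso : ∀ t : T, Nonempty ((fun a b : {s : T // s < t} => (a : T) < (b : T)) ≃r
      Subrel ((· < ·) : K → K → Prop) (· < t.1.1)) := by
    intro t
    let φ : {s : T // s < t} → {i : K // i < t.1.1} := fun s => ⟨s.1.1.1, hT_lt s.2⟩
    have hφ : Function.Bijective φ := by
      constructor
      · intro p q hpq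
        have hpq' : p.1.1.1 = q.1.1.1 := congrArg Subtype.val hpq
        exact Subtype.ext (hT_eq (hcomp p.2.le q.2.le hpq'.le) hpq')
      · rintro ⟨i, hi⟩
        obtain ⟨q, hq, hqi⟩ := hrestrict t i hi
        exact ⟨⟨q, hq⟩, Subtype.ext hqi⟩
    refine ⟨⟨Equiv.ofBijective φ hφ, fun {p q} => ⟨fun hpq => ?_, fun hpq => hT_lt hpq⟩⟩⟩
    have hpq' : p.1.1.1 < q.1.1.1 := hpq
    exact lt_of_le_of_ne (hcomp p.2.le q.2.le hpq'.le) fun heq => hpq'.ne (by rw [heq])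
  have hwo : ∀ t : T, IsWellOrder {s : T // s < t} (fun a b => (a : T) < (b : T)) := fun t =>
    (hiso t).some.toRelEmbedding.isWellOrder
  have hlevel : ∀ t : T, treeLevel hwo t = (Ordinal.ToType.mk.symm t.1.1 : Ordinal) := by
    intro t
    have := hwo t
    exact RelIso.ordinalType_congr (hiso t).some
  have hT_mk : ∀ i : K, #{t : T | t.1.1 = i} < κ := by
    intro i
    have hinj : Function.Injective
        fun (t : {t : T | t.1.1 = i}) (j : Set.Iio i) => t.1.1.2 j := by
      rintro ⟨p, rfl⟩ ⟨q, hq⟩ hpq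
      refine Subtype.ext (hT_eq ⟨hq.ge, fun j hj => congrFun hpq ⟨j, hj⟩⟩ hq.symm)
    refine (mk_le_of_injective hinj).trans_lt ?_
    rw [mk_arrow, lift_id, lift_id]
    let c := max (max #β #(Set.Iio i)) ℵ₀
    have hc : c < κ := max_lt (max_lt hβ (mk_Iio_ord_toType_lt i)) hκ.1.aleph0_lt
    have hc₀ : ℵ₀ ≤ c := le_max_right _ _
    have hβc : #β ≤ c := (le_max_left _ _).trans (le_max_left _ _)
    have hic : #(Set.Iio i) ≤ c := (le_max_right _ _).trans (le_max_left _ _)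
    calc #β ^ #(Set.Iio i) ≤ c ^ #(Set.Iio i) := power_le_power_right hβc
      _ ≤ c ^ c := power_le_power_left (aleph0_pos.trans_le hc₀).ne' hic
      _ = 2 ^ c := power_self_eq hc₀
      _ < κ := hκ.1.isStrongPrelimit hc
  obtain ⟨B, hB, hBκ⟩ := hκ.2 T hwo
    (fun t => hlevel t ▸ (Ordinal.ToType.mk.symm t.1.1).2)
    (fun o ho => by
      let i : K := Ordinal.ToType.mk ⟨o, ho⟩
      refine ⟨⟨(i, cut i (f i)), i, le_rfl, rfl⟩, ?_⟩
      rw [hlevel]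
      simp [i])
    (fun o => by
      by_cases ho : o < κ.ord
      · refine (mk_le_mk_of_subset fun t ht => ?_).trans_lt (hT_mk (Ordinal.ToType.mk ⟨o, ho⟩))
        have ht' : (Ordinal.ToType.mk.symm t.1.1 : Ordinal) = o := (hlevel t).symm.trans ht
        change t.1.1 = _
        rw [← OrderIso.symm_apply_eq]
        exact Subtype.ext ht'
      · refine lt_of_eq_of_lt ?_ hr.pos
        rw [mk_eq_zero_iff]
        refine ⟨fun ⟨t, ht⟩ => ho ?_⟩
        rw [← ht, hlevel]
        exact (Ordinal.ToType.mk.symm t.1.1).2)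
  have hB_unbounded : ∀ i : K, ∃ p ∈ B, i < p.1.1 := by
    intro i
    by_contra! hle
    have hinj : Function.Injective fun p : B => (⟨p.1.1.1, hle p p.2⟩ : Set.Iic i) := by
      rintro ⟨p, hp⟩ ⟨q, hq⟩ hpq
      have hpq' : p.1.1 = q.1.1 := congrArg Subtype.val hpq
      refine Subtype.ext ?_
      rcases hB.total hp hq with h | h
      · exact hT_eq h hpq'
      · exact (hT_eq h hpq'.symm).symm
    have hlt : #(Set.Iic i) < κ := by
      rw [← Set.Iio_insert]
      exact mk_insert_lt_of_aleph0_le hr.aleph0_le (mk_Iio_ord_toType_lt i)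
    exact (hBκ ▸ mk_le_of_injective hinj).not_gt hlt
  choose P hPB hP using hB_unbounded
  have hg : ∀ {p : T} {i : K}, p ∈ B → i < p.1.1 → p.1.2 i = (P i).1.2 i := by
    intro p i hp hi
    rcases hB.total hp (hPB i) with h | h
    · exact h.2 i hi
    · exact (h.2 i (hP i)).symm
  refine ⟨fun i => (P i).1.2 i, fun i => ?_⟩
  obtain ⟨a, ha, hPa⟩ := (P i).2
  refine ⟨a, (hP i).trans_le ha, fun j hj => ?_⟩
  change f a j = (P j).1.2 j
  rw [← hg (hPB i) (hj.trans (hP i)), hPa, hcut (hj.trans (hP i))]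

/-- In a `(<κ)`-compact space, a predicate that agrees on every initial segment of `κ` with the
trace of a point of the sequence `x` on the open sets `U i` is realised, up to inclusion, by the
trace of a single point. -/
theorem KappaCompactSpace.exists_forall_mem_imp {κ : Cardinal.{u}} {X : Type u} [TopologicalSpace X]
    (hX : KappaCompactSpace κ X) (hr : κ.IsRegular) (x : κ.ord.ToType → X)
    (U : κ.ord.ToType → Set X) (hU : ∀ i, IsOpen (U i)) (g : κ.ord.ToType → Prop)
    (hg : ∀ i, ∃ a, ∀ j < i, x a ∈ U j ↔ g j) : ∃ y, ∀ i, y ∈ U i → g i := by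
  by_contra! h
  obtain ⟨𝒱, h𝒱, h𝒱κ, h𝒱cov⟩ := hX (U '' {i | ¬ g i}) (by rintro _ ⟨i, -, rfl⟩; exact hU i)
    (Set.eq_univ_of_forall fun y => by
      obtain ⟨i, hi, hgi⟩ := h y
      exact ⟨U i, ⟨i, hgi, rfl⟩, hi⟩)
  choose i hgi hi using fun V : 𝒱 => h𝒱 V.2
  obtain ⟨γ, hγ⟩ := exists_forall_lt_apply hr h𝒱κ i
  obtain ⟨a, ha⟩ := hg γ
  obtain ⟨V, hV, haV⟩ : x a ∈ ⋃₀ 𝒱 := h𝒱cov ▸ Set.mem_univ _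
  refine hgi ⟨V, hV⟩ ((ha _ (hγ ⟨V, hV⟩)).1 ?_)
  rwa [hi]

theorem WeaklyCompactCard.kappaCompactSpace_prod {κ : Cardinal.{u}} (hκ : WeaklyCompactCard κ)
    {X Y : Type u} [TopologicalSpace X] [TopologicalSpace Y]
    (hX : KappaCompactSpace κ X) (hY : KappaCompactSpace κ Y)
    (hwX : WeightLE X κ) (hwY : WeightLE Y κ) : KappaCompactSpace κ (X × Y) := by
  have hr := hκ.1.isRegular
  intro 𝒰 hopen hcov
  obtain ⟨BX, hBX, hBXκ⟩ := hwX
  obtain ⟨BY, hBY, hBYκ⟩ := hwY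
  let R : Set (BX × BY) := {p | ∃ W ∈ 𝒰, p.1.1 ×ˢ p.2.1 ⊆ W}
  have hRcov : ∀ z : X × Y, ∃ p ∈ R, z ∈ p.1.1 ×ˢ p.2.1 := by
    intro z
    obtain ⟨W, hW, hz⟩ : z ∈ ⋃₀ 𝒰 := hcov ▸ Set.mem_univ z
    obtain ⟨_, ⟨U, hU, V, hV, rfl⟩, hzUV, hUV⟩ :=
      (hBX.prod hBY).exists_subset_of_mem_open hz (hopen W hW)
    exact ⟨(⟨U, hU⟩, ⟨V, hV⟩), ⟨W, hW, hUV⟩, hzUV⟩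
  by_cases hne : Nonempty (X × Y)
  swap
  · exact ⟨∅, Set.empty_subset _, by simpa using hr.pos,
      Set.eq_univ_of_forall fun z => absurd ⟨z⟩ hne⟩
  have hRne : Nonempty R := by
    obtain ⟨p, hp, -⟩ := hRcov hne.some
    exact ⟨⟨p, hp⟩⟩
  have hRκ : #R ≤ #κ.ord.ToType := by
    rw [mk_ord_toType]
    refine (mk_le_of_injective Subtype.val_injective).trans ?_
    rw [mk_prod, lift_id, lift_id]
    exact (mul_le_mul' hBXκ hBYκ).trans (mul_eq_self hr.aleph0_le).le
  obtain ⟨e⟩ : Nonempty (R ↪ κ.ord.ToType) := hRκ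
  let ρ : κ.ord.ToType → R := Function.invFun e
  have hρ : Function.Surjective ρ := Function.invFun_surjective e.injective
  by_contra! hsub
  choose W hW hρW using fun i => (ρ i).2
  have hz : ∀ a, ∃ z : X × Y, ∀ i < a, ¬ (z.1 ∈ (ρ i).1.1.1 ∧ z.2 ∈ (ρ i).1.2.1) := by
    intro a
    have hne := hsub (W '' Set.Iio a) (by rintro _ ⟨i, -, rfl⟩; exact hW i)
      (mk_image_le.trans_lt (mk_Iio_ord_toType_lt a))
    obtain ⟨z, hz⟩ := (Set.ne_univ_iff_exists_notMem _).1 hne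
    exact ⟨z, fun i hi hzi => hz ⟨W i, ⟨i, hi, rfl⟩, hρW i hzi⟩⟩
  choose z hz using hz
  obtain ⟨g, hg⟩ := hκ.exists_coherent (β := ULift.{u} (Prop × Prop))
    ((lt_aleph0_of_finite _).trans hκ.1.aleph0_lt)
    fun a i => ⟨((z a).1 ∈ (ρ i).1.1.1, (z a).2 ∈ (ρ i).1.2.1)⟩
  obtain ⟨x, hx⟩ := hX.exists_forall_mem_imp hr (fun a => (z a).1) (fun i => (ρ i).1.1.1)
    (fun i => hBX.isOpen (ρ i).1.1.2) (fun i => (g i).down.1) fun i => by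
      obtain ⟨a, -, ha⟩ := hg i
      exact ⟨a, fun j hj => (congrArg (fun p => p.down.1) (ha j hj)).to_iff⟩
  obtain ⟨y, hy⟩ := hY.exists_forall_mem_imp hr (fun a => (z a).2) (fun i => (ρ i).1.2.1)
    (fun i => hBY.isOpen (ρ i).1.2.2) (fun i => (g i).down.2) fun i => by
      obtain ⟨a, -, ha⟩ := hg i
      exact ⟨a, fun j hj => (congrArg (fun p => p.down.2) (ha j hj)).to_iff⟩
  obtain ⟨p, hp, hxp, hyp⟩ := hRcov (x, y)
  obtain ⟨i, hi⟩ := hρ ⟨p, hp⟩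
  obtain ⟨j, hj⟩ := exists_forall_lt_apply hr (ι := PUnit)
    ((lt_aleph0_of_finite _).trans hκ.1.aleph0_lt) fun _ => i
  obtain ⟨a, hja, ha⟩ := hg j
  have hij : i < j := hj ⟨⟩
  have hgi := ha i hij
  refine hz a i (hij.trans hja)
    ⟨((congrArg (fun p => p.down.1) hgi).to_iff).2 (hx i (by rwa [hi])),
      ((congrArg (fun p => p.down.2) hgi).to_iff).2 (hy i (by rwa [hi]))⟩
theorem weaklyCompact_iff_GO_products (κ : Cardinal.{u}) (hκ : ℵ₀ < κ)
    (hcard : κ ^< κ = κ) :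
    WeaklyCompactCard κ ↔
      ∀ (X Y : Type u) [TopologicalSpace X] [TopologicalSpace Y]
        [LinearOrder X] [LinearOrder Y], IsGOSpace X → IsGOSpace Y →
        KappaCompactSpace κ X → KappaCompactSpace κ Y →
        WeightLE X κ → WeightLE Y κ →
        KappaCompactSpace κ (X × Y) := by
  constructor
  · intro h X Y _ _ _ _ _ _ hX hY hwX hwY
    exact h.kappaCompactSpace_prod hX hY hwX hwY
  · intro H
    have hr := isRegular_of_powerlt_eq hκ hcard
    have hmono := fun (L : Type u) [LinearOrder L] (hL : #L = κ) =>
      exists_monotone_sequence_of_products hκ hcard H L hL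
    exact ⟨⟨hκ, hr.le_cof_ord, isStrongPrelimit_of_monotone_sequences hr hcard hmono⟩,
      treeProperty_of_monotone_sequences hr hmono⟩
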